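/- For every real x with 0 < x < π/2, one has [(2π⁴/3)x³ + (8π⁴/15 − 16π²/3)x⁵]/(π² − 4x²)² < x·sec²x − tan x < [(2π⁴/3)x³ + (256/π² − 8π²/3)x⁵]/(π² − 4x²)². -/

import Mathlib

open Real

lemma cot_real_hasSum (z : ℝ) (h0 : 0 < z) (h1 : z < 1) :
    HasSum (fun n : ℕ => 2 * z / (z ^ 2 - ((n : ℝ) + 1) ^ 2))
      (π * (Real.cos (π * z) / Real.sin (π * z)) - 1 / z) := by
  have hz : (z : ℂ) ∈ Complex.integerComplement := by
    rintro ⟨n, hn⟩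
    have hn' : (n : ℝ) = z := by exact_mod_cast hn
    rw [← hn'] at h0 h1
    have a0 : 0 < n := by exact_mod_cast h0
    have a1 : n < 1 := by exact_mod_cast h1
    omega
  have hs := summable_cotTerm hz
  have h := hs.hasSum
  have e := cot_series_rep' hz
  have e2 : ∑' n, cotTerm (z : ℂ) n = ((π * (Real.cos (π * z) / Real.sin (π * z)) - 1 / z : ℝ) : ℂ) := by
    have : ∑' n, cotTerm (z : ℂ) n = ∑' n : ℕ, (1 / ((z : ℂ) - (n + 1)) + 1 / (z + (n + 1))) := rfl
    rw [this, ← e, Complex.cot]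
    push_cast
    rfl
  rw [e2] at h
  have e3 : (fun n => cotTerm (z : ℂ) n) =
      fun n : ℕ => ((2 * z / (z ^ 2 - ((n : ℝ) + 1) ^ 2) : ℝ) : ℂ) := by
    funext n
    rw [cotTerm_identity hz]
    push_cast
    rw [mul_one_div]
    congr 1
    ring
  change HasSum (fun n => cotTerm (z : ℂ) n) _ at h
  rw [e3] at h
  exact_mod_cast h

lemma odd_hasSum {f : ℕ → ℝ} {s e : ℝ} (h : HasSum f s)
    (he : HasSum (fun k => f (2 * k + 1)) e) : HasSum (fun k => f (2 * k)) (s - e) := by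
  have hs : Summable (fun k => f (2 * k)) :=
    h.summable.comp_injective (i := fun k : ℕ => 2 * k) (fun a b hab => by simpa using hab)
  have := hs.hasSum.even_add_odd he
  have e1 := this.unique h
  have : ∑' k, f (2 * k) = s - e := by linarith
  rw [← this]
  exact hs.hasSum

lemma tan_hasSum (x : ℝ) (hx0 : 0 < x) (hx : x < π / 2) :
    HasSum (fun k : ℕ => 8 / ((2 * (k : ℝ) + 1) ^ 2 * π ^ 2 - 4 * x ^ 2)) (Real.tan x / x) := by
  have hpi := Real.pi_pos
  have hz0 : 0 < x / π := by positivity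
  have hz1 : 2 * (x / π) < 1 := by
    rw [← mul_div_assoc, div_lt_one hpi]; linarith
  have hA := cot_real_hasSum (x / π) hz0 (by linarith)
  have hB := cot_real_hasSum (2 * (x / π)) (by linarith) hz1
  have hO := odd_hasSum hB (e := (1 / 2) * (π * (Real.cos (π * (x / π)) / Real.sin (π * (x / π))) - 1 / (x / π))) (by
    convert! hA.mul_left (1 / 2) using 2 with k
    push_cast
    rw [show (2 * (x / π)) ^ 2 - (2 * (k : ℝ) + 1 + 1) ^ 2 = 4 * ((x / π) ^ 2 - (k + 1) ^ 2) by ring]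
    generalize (x / π) ^ 2 - ((k : ℝ) + 1) ^ 2 = w
    by_cases hw : w = 0
    · simp [hw]
    · field_simp; ring)
  have e1 : π * (x / π) = x := by field_simp
  have e2 : π * (2 * (x / π)) = 2 * x := by field_simp
  rw [e1, e2] at hO
  have hc : Real.cos x ≠ 0 := (Real.cos_pos_of_mem_Ioo ⟨by linarith, hx⟩).ne'
  have hsn : Real.sin x ≠ 0 := (Real.sin_pos_of_pos_of_lt_pi hx0 (by linarith)).ne'
  convert! hO.mul_left (-2 / (π * x)) using 1
  · funext k
    push_cast
    have hw : (2 * (k : ℝ) + 1) ^ 2 * π ^ 2 - 4 * x ^ 2 ≠ 0 := by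
      have : (0 : ℝ) ≤ k := Nat.cast_nonneg k
      have h3 : 1 * π ^ 2 ≤ (2 * (k : ℝ) + 1) ^ 2 * π ^ 2 := by
        gcongr; nlinarith
      nlinarith
    have : (2 * (x / π)) ^ 2 - (2 * (k : ℝ) + 1) ^ 2 =
        - ((2 * (k : ℝ) + 1) ^ 2 * π ^ 2 - 4 * x ^ 2) / π ^ 2 := by
      field_simp; ring
    rw [this]
    generalize (2 * (k : ℝ) + 1) ^ 2 * π ^ 2 - 4 * x ^ 2 = w at hw
    field_simp
    ring
  · rw [Real.tan_eq_sin_div_cos, Real.cos_two_mul, Real.sin_two_mul]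
    have hsc := Real.sin_sq_add_cos_sq x
    field_simp
    have : Real.sin x ^ 2 = 1 - Real.cos x ^ 2 := by linarith
    simp only [this]
    ring

lemma sec_hasSum (x : ℝ) (hx0 : 0 < x) (hx : x < π / 2) :
    HasSum (fun k : ℕ => 64 * x ^ 3 / ((2 * (k : ℝ) + 1) ^ 2 * π ^ 2 - 4 * x ^ 2) ^ 2)
      (x * (1 / Real.cos x) ^ 2 - Real.tan x) := by
  have hpi := Real.pi_pos
  obtain ⟨r, hxr, hr⟩ := exists_between hx
  have hr0 : 0 < r := hx0.trans hxr
  have hd : 0 < π ^ 2 - 4 * r ^ 2 := by nlinarith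
  have hbig : ∀ (k : ℕ) (y : ℝ), y ∈ Set.Ioo 0 r →
      (2 * (k : ℝ) + 1) ^ 2 * (π ^ 2 - 4 * r ^ 2) ≤ (2 * (k : ℝ) + 1) ^ 2 * π ^ 2 - 4 * y ^ 2 := by
    rintro k y ⟨hy0, hy⟩
    have : (0 : ℝ) ≤ k := Nat.cast_nonneg k
    have h1 : (1 : ℝ) ≤ (2 * (k : ℝ) + 1) ^ 2 := by nlinarith
    have h2 : y ^ 2 ≤ r ^ 2 := by gcongr
    nlinarith [sq_nonneg r]
  have hpos : ∀ (k : ℕ), 0 < (2 * (k : ℝ) + 1) ^ 2 * (π ^ 2 - 4 * r ^ 2) := by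
    intro k; positivity
  have hu : Summable (fun k : ℕ => 64 * r / ((2 * (k : ℝ) + 1) ^ 2 * (π ^ 2 - 4 * r ^ 2)) ^ 2) := by
    have h := hasSum_zeta_four.summable.comp_injective (i := fun k : ℕ => 2 * k + 1)
      (fun a b hab => by simpa using hab)
    convert! h.mul_left (64 * r / (π ^ 2 - 4 * r ^ 2) ^ 2) using 2 with k
    simp only [Function.comp]
    push_cast
    have : (2 * (k : ℝ) + 1) ≠ 0 := by positivity
    field_simp
  have hg' : ∀ (k : ℕ) (y : ℝ), y ∈ Set.Ioo 0 r →
      ‖64 * y / ((2 * (k : ℝ) + 1) ^ 2 * π ^ 2 - 4 * y ^ 2) ^ 2‖ ≤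
        64 * r / ((2 * (k : ℝ) + 1) ^ 2 * (π ^ 2 - 4 * r ^ 2)) ^ 2 := by
    intro k y hy
    have h1 := hbig k y hy
    have h2 := hpos k
    have hy0 := hy.1
    rw [Real.norm_of_nonneg (by positivity)]
    have := hy.2.le
    gcongr
  have hD := hasDerivAt_tsum_of_isPreconnected (𝕜 := ℝ) (t := Set.Ioo 0 r)
    (g := fun (k : ℕ) (y : ℝ) => 8 / ((2 * (k : ℝ) + 1) ^ 2 * π ^ 2 - 4 * y ^ 2))
    (g' := fun (k : ℕ) (y : ℝ) => 64 * y / ((2 * (k : ℝ) + 1) ^ 2 * π ^ 2 - 4 * y ^ 2) ^ 2)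
    (y₀ := x) (y := x) hu isOpen_Ioo isPreconnected_Ioo
    (by
      intro k y hy
      have hne : (2 * (k : ℝ) + 1) ^ 2 * π ^ 2 - 4 * y ^ 2 ≠ 0 :=
        ((hpos k).trans_le (hbig k y hy)).ne'
      have h1 : HasDerivAt (fun y : ℝ => (2 * (k : ℝ) + 1) ^ 2 * π ^ 2 - 4 * y ^ 2) (-(8 * y)) y := by
        have := ((hasDerivAt_pow 2 y).const_mul 4).const_sub ((2 * (k : ℝ) + 1) ^ 2 * π ^ 2)
        convert! this using 1
        push_cast; ring
      convert! (hasDerivAt_const y (8 : ℝ)).div h1 hne using 1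
      ring)
    hg' ⟨hx0, hxr⟩ (tan_hasSum x hx0 hx).summable ⟨hx0, hxr⟩
  have hc : Real.cos x ≠ 0 := (Real.cos_pos_of_mem_Ioo ⟨by linarith, hx⟩).ne'
  have hT := (Real.hasDerivAt_tan hc).div (hasDerivAt_id x) hx0.ne'
  have hE : (fun y => ∑' k : ℕ, 8 / ((2 * (k : ℝ) + 1) ^ 2 * π ^ 2 - 4 * y ^ 2)) =ᶠ[nhds x]
      (fun y => Real.tan y / y) := by
    filter_upwards [Ioo_mem_nhds hx0 hx] with y hy
    exact (tan_hasSum y hy.1 hy.2).tsum_eq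
  have hD' := hD.congr_of_eventuallyEq hE.symm
  have hval := hD'.unique hT
  have hsum : Summable (fun k : ℕ => 64 * x / ((2 * (k : ℝ) + 1) ^ 2 * π ^ 2 - 4 * x ^ 2) ^ 2) :=
    Summable.of_norm_bounded hu (fun k => hg' k x ⟨hx0, hxr⟩)
  have hS := hsum.hasSum
  rw [hval] at hS
  convert! hS.mul_left (x ^ 2) using 1
  · funext k; ring
  · simp only [id]
    field_simp

lemma odd_four : HasSum (fun k : ℕ => 1 / (2 * (k : ℝ) + 1) ^ 4) (π ^ 4 / 96) := by
  have h := hasSum_zeta_four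
  have h0 := (hasSum_nat_add_iff' 1).mpr h
  have hO := odd_hasSum h0 (e := 1 / 16 * (π ^ 4 / 90)) (by
    convert! h0.mul_left (1 / 16) using 1
    · funext k
      push_cast
      rw [show (2 * (k : ℝ) + 1 + 1) = 2 * (k + 1) by ring, mul_pow]
      have : (k : ℝ) + 1 ≠ 0 := by positivity
      field_simp; norm_num
    · simp)
  convert! hO using 1
  · funext k; push_cast; rfl
  · simp; ring

lemma zeta_six : HasSum (fun n : ℕ => (1 : ℝ) / (n : ℝ) ^ 6) (π ^ 6 / 945) := by
  have b5 : bernoulli' 5 = 0 := by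
    have c1 : Nat.choose 5 2 = 10 := by decide
    have c2 : Nat.choose 5 3 = 10 := by decide
    have c3 : Nat.choose 5 4 = 5 := by decide
    rw [bernoulli'_def]
    norm_num [Finset.sum_range_succ, c1, c2, c3]
  have b6 : bernoulli' 6 = 1 / 42 := by
    have c1 : Nat.choose 6 2 = 15 := by decide
    have c2 : Nat.choose 6 3 = 20 := by decide
    have c3 : Nat.choose 6 4 = 15 := by decide
    have c4 : Nat.choose 6 5 = 6 := by decide
    rw [bernoulli'_def]
    norm_num [Finset.sum_range_succ, c1, c2, c3, c4, b5]
  convert! hasSum_zeta_nat three_ne_zero using 1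
  simp only [Nat.reduceAdd, Nat.reduceMul, Nat.reduceSub]
  rw [bernoulli_eq_bernoulli'_of_ne_one (by decide), b6]
  simp [Nat.factorial]; ring

lemma odd_six : HasSum (fun k : ℕ => 1 / (2 * (k : ℝ) + 1) ^ 6) (π ^ 6 / 960) := by
  have h := zeta_six
  have h0 := (hasSum_nat_add_iff' 1).mpr h
  have hO := odd_hasSum h0 (e := 1 / 64 * (π ^ 6 / 945)) (by
    convert! h0.mul_left (1 / 64) using 1
    · funext k
      push_cast
      rw [show (2 * (k : ℝ) + 1 + 1) = 2 * (k + 1) by ring, mul_pow]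
      have : (k : ℝ) + 1 ≠ 0 := by positivity
      field_simp; norm_num
    · simp)
  convert! hO using 1
  · funext k; push_cast; rfl
  · simp; ring

lemma lower_term (m u : ℝ) (hm : 1 ≤ m) (hu1 : u < 1) :
    (1 - u) ^ 2 / (m - u) ^ 2 - (1 / m ^ 2 + 2 * u * (1 / m ^ 3 - 1 / m ^ 2)) =
      u ^ 2 * (m - 1) * (m ^ 2 - 3 * m + 2 * u) / (m ^ 3 * (m - u) ^ 2) := by
  have : m - u ≠ 0 := by linarith
  have : m ≠ 0 := by linarith
  field_simp
  ring

lemma upper_term (m u : ℝ) (hm : 1 ≤ m) (hu1 : u < 1) :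
    (1 - u) / m ^ 2 - (1 - u) ^ 2 / (m - u) ^ 2 =
      (1 - u) * u * (m ^ 2 - 2 * m + u) / (m ^ 2 * (m - u) ^ 2) := by
  have : m - u ≠ 0 := by linarith
  have : m ≠ 0 := by linarith
  field_simp
  ring

lemma m_big (k : ℕ) (hk : k ≠ 0) : (9 : ℝ) ≤ (2 * (k : ℝ) + 1) ^ 2 := by
  have : (1 : ℝ) ≤ k := by exact_mod_cast Nat.one_le_iff_ne_zero.mpr hk
  nlinarith

lemma lower_pos (m u : ℝ) (hm : 9 ≤ m) (hu0 : 0 < u) (hu1 : u < 1) :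
    1 / m ^ 2 + 2 * u * (1 / m ^ 3 - 1 / m ^ 2) < (1 - u) ^ 2 / (m - u) ^ 2 := by
  rw [← sub_pos, lower_term m u (by linarith) hu1]
  have h1 : 0 < m - 1 := by linarith
  have h2 : 0 < m - u := by linarith
  have h3 : 0 < m := by linarith
  have h4 : 0 < m ^ 2 - 3 * m + 2 * u := by nlinarith
  positivity

lemma upper_pos (m u : ℝ) (hm : 9 ≤ m) (hu0 : 0 < u) (hu1 : u < 1) :
    (1 - u) ^ 2 / (m - u) ^ 2 < (1 - u) / m ^ 2 := by
  rw [← sub_pos, upper_term m u (by linarith) hu1]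
  have h1 : 0 < 1 - u := by linarith
  have h2 : 0 < m - u := by linarith
  have h3 : 0 < m := by linarith
  have h4 : 0 < m ^ 2 - 2 * m + u := by nlinarith
  positivity

theorem papenfuss_bach_open_problem (x : ℝ) (hx0 : 0 < x) (hx : x < π / 2) :
    ((2*π^4/3) * x^3 + (8*π^4/15 - 16*π^2/3) * x^5) / (π^2 - 4*x^2)^2
      < x * (1 / Real.cos x)^2 - Real.tan x ∧
    x * (1 / Real.cos x)^2 - Real.tan x <
      ((2*π^4/3) * x^3 + (256/π^2 - 8*π^2/3) * x^5) / (π^2 - 4*x^2)^2 := by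
  have hpi := Real.pi_pos
  have hd : 0 < π ^ 2 - 4 * x ^ 2 := by nlinarith
  obtain ⟨u, hu⟩ : ∃ u, u = 4 * x ^ 2 / π ^ 2 := ⟨_, rfl⟩
  have hu0 : 0 < u := by rw [hu]; positivity
  have hu1 : u < 1 := by rw [hu, div_lt_one (by positivity)]; linarith
  have hxu : 4 * x ^ 2 = u * π ^ 2 := by rw [hu]; field_simp
  have hne : 1 - u ≠ 0 := by linarith
  have hdu : π ^ 2 - 4 * x ^ 2 = (1 - u) * π ^ 2 := by rw [hxu]; ring
  have hS := (sec_hasSum x hx0 hx).mul_left ((π ^ 2 - 4 * x ^ 2) ^ 2 / (64 * x ^ 3))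
  have hS' : HasSum (fun k : ℕ => (1 - u) ^ 2 / ((2 * (k : ℝ) + 1) ^ 2 - u) ^ 2)
      ((π ^ 2 - 4 * x ^ 2) ^ 2 / (64 * x ^ 3) * (x * (1 / Real.cos x) ^ 2 - Real.tan x)) := by
    convert! hS using 1
    funext k
    rw [hdu, hxu, show (2 * (k : ℝ) + 1) ^ 2 * π ^ 2 - u * π ^ 2
      = ((2 * (k : ℝ) + 1) ^ 2 - u) * π ^ 2 by ring]
    have : (2 * (k : ℝ) + 1) ^ 2 - u ≠ 0 := by
      have : (0 : ℝ) ≤ k := Nat.cast_nonneg k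
      nlinarith
    generalize (2 * (k : ℝ) + 1) ^ 2 - u = w at this
    field_simp
  have e4 : ∀ k : ℕ, 1 / ((2 * (k : ℝ) + 1) ^ 2) ^ 2 = 1 / (2 * (k : ℝ) + 1) ^ 4 := by
    intro k; rw [← pow_mul]
  have e6 : ∀ k : ℕ, 1 / ((2 * (k : ℝ) + 1) ^ 2) ^ 3 = 1 / (2 * (k : ℝ) + 1) ^ 6 := by
    intro k; rw [← pow_mul]
  have hL : HasSum (fun k : ℕ => 1 / ((2 * (k : ℝ) + 1) ^ 2) ^ 2 +
      2 * u * (1 / ((2 * (k : ℝ) + 1) ^ 2) ^ 3 - 1 / ((2 * (k : ℝ) + 1) ^ 2) ^ 2))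
      (π ^ 4 / 96 + 2 * u * (π ^ 6 / 960 - π ^ 4 / 96)) := by
    simp only [e4, e6]
    exact odd_four.add ((odd_six.sub odd_four).mul_left (2 * u))
  have hU : HasSum (fun k : ℕ => (1 - u) / ((2 * (k : ℝ) + 1) ^ 2) ^ 2 + (if k = 0 then u else 0))
      ((1 - u) * (π ^ 4 / 96) + u) := by
    have h := (odd_four.mul_left (1 - u)).add (hasSum_ite_eq (0 : ℕ) u)
    convert! h using 3 with k
    rw [← e4 k, mul_one_div]
  have hlt1 := hasSum_lt (i := 1) (fun k => by
      by_cases hk : k = 0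
      · subst hk
        have : (1 - u) ^ 2 / (1 - u) ^ 2 = 1 := by field_simp
        simp [this]
      · exact (lower_pos _ u (m_big k hk) hu0 hu1).le)
    (lower_pos _ u (m_big 1 one_ne_zero) hu0 hu1) hL hS'
  have hlt2 := hasSum_lt (i := 1) (fun k => by
      by_cases hk : k = 0
      · subst hk
        have : (1 - u) ^ 2 / (1 - u) ^ 2 = 1 := by field_simp
        simp [this]
      · simpa [hk] using (upper_pos _ u (m_big k hk) hu0 hu1).le)
    (by simpa using (upper_pos _ u (m_big 1 one_ne_zero) hu0 hu1)) hS' hU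
  have hx3 : 0 < 64 * x ^ 3 := by positivity
  rw [div_mul_eq_mul_div, lt_div_iff₀ hx3] at hlt1
  rw [div_mul_eq_mul_div, div_lt_iff₀ hx3] at hlt2
  constructor
  · rw [div_lt_iff₀ (by positivity)]
    convert! hlt1 using 1
    · rw [hu]; field_simp; ring
    · ring
  · rw [lt_div_iff₀ (by positivity)]
    convert! hlt2 using 1
    · ring
    · rw [hu]; field_simp; ring
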